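/- Let a > 0. For n ≥ 1 set h = 1/(2n+a+1) and x_i = h(a−1+i) for i=1,…,2n+1. Let M be the (n+1)×n lower bidiagonal matrix with m_{kk} = √(n+1−k) for k=1,…,n and m_{k+1,k} = √(a+n−k) for k=1,…,n, and define the n×(n+1) matrix M_hard = −√(2/h) · F_n Ω_n Mᵀ Ω_{n+1} F_{n+1}. Define E = M_hard − [ −2·diag(√x_2, √x_4, …, √x_{2n})·(1/(2h))∇_{n,n+1} + (a−1)·diag(1/√x_2, 1/√x_4, …, 1/√x_{2n})·S_{n,n+1} ]. Then E is upper bidiagonal with entries E_{ii} = (1/h)(√(x_{2i}+h(a−1)) − √(x_{2i})) − (a−1)/(2√(x_{2i})) and E_{i,i+1} = −(1/h)(√(x_{2i}−h(a−1)) − √(x_{2i})) − (a−1)/(2√(x_{2i})) for i=1,…,n; moreover, for every ε > 0 there exist C > 0 and n₀ such that for all n ≥ n₀, every entry of E in a row i with i ≥ ε/h has absolute value at most C·h. -/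

import Mathlib

open Matrix Real

noncomputable section

/-- Mesh size `h = 1/(2n+a+1)` for the hard edge of the rectangular Laguerre model. -/
def besselH (a : ℝ) (n : ℕ) : ℝ := 1 / (2 * n + a + 1)

/-- Grid points `x_i = h(a−1+i)`. -/
def besselX' (a : ℝ) (n : ℕ) (i : ℕ) : ℝ := besselH a n * (a - 1 + i)

/-- The `(n+1)×n` ∞-Laguerre matrix model: lower bidiagonal with
`m_{kk} = √(n+1−k)` and `m_{k+1,k} = √(a+n−k)` (1-based indexing). -/
def laguerreMinf (a : ℝ) (n : ℕ) : Matrix (Fin (n + 1)) (Fin n) ℝ :=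
  Matrix.of fun i j =>
    if (i : ℕ) = (j : ℕ) then Real.sqrt ((n : ℝ) - (j : ℕ))
    else if (i : ℕ) = (j : ℕ) + 1 then Real.sqrt (a + n - 1 - (j : ℕ))
    else 0

/-- The `m×m` flip permutation matrix `F`. -/
def flipMat (m : ℕ) : Matrix (Fin m) (Fin m) ℝ :=
  Matrix.of fun i j => if (i : ℕ) + (j : ℕ) = m - 1 then 1 else 0

/-- `Ω_m`, diagonal with `(i,i)` entry `(−1)^i` (1-based indexing). -/
def omegaMat (m : ℕ) : Matrix (Fin m) (Fin m) ℝ :=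
  Matrix.diagonal fun i => (-1 : ℝ) ^ ((i : ℕ) + 1)

/-- `∇_{n,n+1}`, the `n×(n+1)` upper bidiagonal matrix with `−1` on the
diagonal and `1` on the superdiagonal. -/
def gradMatRect (n : ℕ) : Matrix (Fin n) (Fin (n + 1)) ℝ :=
  Matrix.of fun i j =>
    if (j : ℕ) = (i : ℕ) then -1 else if (j : ℕ) = (i : ℕ) + 1 then 1 else 0

/-- `S_{n,n+1}`, the `n×(n+1)` upper bidiagonal matrix with `1/2` on the
diagonal and superdiagonal. -/
def sMatRect (n : ℕ) : Matrix (Fin n) (Fin (n + 1)) ℝ :=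
  Matrix.of fun i j =>
    if (j : ℕ) = (i : ℕ) ∨ (j : ℕ) = (i : ℕ) + 1 then (1 : ℝ) / 2 else 0

/-- The rectangular ∞-Laguerre matrix model scaled at the hard edge,
`M_hard = −√(2/h)·FₙΩₙMᵀΩ_{n+1}F_{n+1}`. -/
def laguerreMhard (a : ℝ) (n : ℕ) : Matrix (Fin n) (Fin (n + 1)) ℝ :=
  (-Real.sqrt (2 / besselH a n)) •
    (flipMat n * omegaMat n * (laguerreMinf a n)ᵀ * omegaMat (n + 1) * flipMat (n + 1))

/-- The error term `E` in the finite difference interpretation of the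
hard-edge–scaled rectangular Laguerre model. -/
def laguerreMhardErr (a : ℝ) (n : ℕ) : Matrix (Fin n) (Fin (n + 1)) ℝ :=
  laguerreMhard a n -
    ((-2 : ℝ) • (Matrix.diagonal (fun i : Fin n =>
        Real.sqrt (besselX' a n (2 * (i : ℕ) + 2))) *
      ((1 / (2 * besselH a n)) • gradMatRect n)) +
     (a - 1) • (Matrix.diagonal (fun i : Fin n =>
        1 / Real.sqrt (besselX' a n (2 * (i : ℕ) + 2))) * sMatRect n))

lemma besselH_pos {a : ℝ} (ha : 0 < a) (n : ℕ) : 0 < besselH a n := by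
  unfold besselH
  positivity

lemma flipMat_mul_apply {m k : ℕ} (A : Matrix (Fin m) (Fin k) ℝ) (i : Fin m) (j : Fin k) :
    (flipMat m * A) i j = A i.rev j := by
  rw [Matrix.mul_apply, Finset.sum_eq_single i.rev]
  · have h : (i : ℕ) + (i.rev : ℕ) = m - 1 := by rw [Fin.val_rev]; omega
    rw [flipMat, Matrix.of_apply, if_pos h, one_mul]
  · intro b _ hb
    have h : ¬ (i : ℕ) + (b : ℕ) = m - 1 := by
      intro h
      apply hb
      ext
      rw [Fin.val_rev]
      omega
    simp [flipMat, h]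
  · simp

lemma mul_flipMat_apply {m k : ℕ} (A : Matrix (Fin m) (Fin k) ℝ) (i : Fin m) (j : Fin k) :
    (A * flipMat k) i j = A i j.rev := by
  rw [Matrix.mul_apply, Finset.sum_eq_single j.rev]
  · have h : (j.rev : ℕ) + (j : ℕ) = k - 1 := by rw [Fin.val_rev]; omega
    rw [flipMat, Matrix.of_apply, if_pos h, mul_one]
  · intro b _ hb
    have h : ¬ (b : ℕ) + (j : ℕ) = k - 1 := by
      intro h
      apply hb
      ext
      rw [Fin.val_rev]
      omega
    simp [flipMat, h]
  · simp

lemma laguerreMhard_apply (a : ℝ) (n : ℕ) (i : Fin n) (j : Fin (n + 1)) :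
    laguerreMhard a n i j =
      if (j : ℕ) = i then √(2 / besselH a n) * √(a + (i : ℕ))
      else if (j : ℕ) = i + 1 then -(√(2 / besselH a n) * √((i : ℕ) + 1))
      else 0 := by
  have hi := i.isLt
  have hj := j.isLt
  have hcast : (((n - (i + 1) : ℕ)) : ℝ) = n - ((i : ℕ) + 1) := by
    rw [Nat.cast_sub (by omega)]
    push_cast
    ring
  rw [laguerreMhard, Matrix.smul_apply, mul_flipMat_apply, omegaMat, omegaMat,
    Matrix.mul_diagonal, Matrix.mul_assoc, flipMat_mul_apply]
  rw [Matrix.diagonal_mul, Matrix.transpose_apply, laguerreMinf, Matrix.of_apply,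
    Fin.val_rev, Fin.val_rev, smul_eq_mul, hcast]
  have hsign : ∀ k : ℕ, (-1 : ℝ) ^ k * (-1) ^ k = 1 := fun k => by
    rw [← mul_pow]
    norm_num
  by_cases h₁ : (j : ℕ) = i
  · rw [if_neg (by omega), if_pos (by omega), if_pos h₁,
      show n + 1 - ((j : ℕ) + 1) = n - ((i : ℕ) + 1) + 1 by omega,
      show a + n - 1 - (n - ((i : ℕ) + 1)) = a + (i : ℕ) by ring]
    linear_combination √(2 / besselH a n) * √(a + (i : ℕ)) * hsign (n - ((i : ℕ) + 1) + 1)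
  · rw [if_neg h₁]
    by_cases h₂ : (j : ℕ) = i + 1
    · rw [if_pos (by omega), if_pos h₂,
        show n + 1 - ((j : ℕ) + 1) = n - ((i : ℕ) + 1) by omega, sub_sub_cancel]
      linear_combination
        -(√(2 / besselH a n) * √((i : ℕ) + 1)) * hsign (n - ((i : ℕ) + 1) + 1)
    · rw [if_neg (by omega), if_neg (by omega), if_neg h₂]
      ring

lemma laguerreMhardErr_apply (a : ℝ) (n : ℕ) (i : Fin n) (j : Fin (n + 1)) :
    laguerreMhardErr a n i j = laguerreMhard a n i j -
      (-2 * (√(besselX' a n (2 * (i : ℕ) + 2)) *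
          (1 / (2 * besselH a n) * gradMatRect n i j)) +
        (a - 1) * (1 / √(besselX' a n (2 * (i : ℕ) + 2)) * sMatRect n i j)) := by
  simp only [laguerreMhardErr, Matrix.sub_apply, Matrix.add_apply, Matrix.smul_apply,
    Matrix.diagonal_mul, smul_eq_mul]

lemma sqrt_two_div_mul_sqrt {h : ℝ} (hh : 0 < h) (y : ℝ) :
    √(2 / h) * √y = 1 / h * √(h * (2 * y)) := by
  rw [← Real.sqrt_mul (by positivity), show h * (2 * y) = h ^ 2 * (2 / h * y) by field_simp,
    Real.sqrt_mul (by positivity) (2 / h * y), Real.sqrt_sq hh.le]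
  field_simp

lemma laguerreMhardErr_eq_zero (a : ℝ) (n : ℕ) (i : Fin n) (j : Fin (n + 1))
    (h₁ : (j : ℕ) ≠ i) (h₂ : (j : ℕ) ≠ i + 1) : laguerreMhardErr a n i j = 0 := by
  simp [laguerreMhardErr_apply, laguerreMhard_apply, gradMatRect, sMatRect, h₁, h₂]

lemma laguerreMhardErr_castSucc {a : ℝ} (ha : 0 < a) (n : ℕ) (i : Fin n) :
    laguerreMhardErr a n i i.castSucc =
      (1 / besselH a n) *
          (√(besselX' a n (2 * (i : ℕ) + 2) + besselH a n * (a - 1))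
            - √(besselX' a n (2 * (i : ℕ) + 2)))
        - (a - 1) / (2 * √(besselX' a n (2 * (i : ℕ) + 2))) := by
  have hx : besselX' a n (2 * (i : ℕ) + 2) + besselH a n * (a - 1)
      = besselH a n * (2 * (a + (i : ℕ))) := by
    simp only [besselX']
    push_cast
    ring
  rw [laguerreMhardErr_apply, laguerreMhard_apply, hx]
  simp only [gradMatRect, sMatRect, Matrix.of_apply, Fin.val_castSucc, if_true, true_or]
  rw [sqrt_two_div_mul_sqrt (besselH_pos ha n)]
  ring

lemma laguerreMhardErr_succ {a : ℝ} (ha : 0 < a) (n : ℕ) (i : Fin n) :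
    laguerreMhardErr a n i i.succ =
      -(1 / besselH a n) *
          (√(besselX' a n (2 * (i : ℕ) + 2) - besselH a n * (a - 1))
            - √(besselX' a n (2 * (i : ℕ) + 2)))
        - (a - 1) / (2 * √(besselX' a n (2 * (i : ℕ) + 2))) := by
  have hx : besselX' a n (2 * (i : ℕ) + 2) - besselH a n * (a - 1)
      = besselH a n * (2 * ((i : ℕ) + 1)) := by
    simp only [besselX']
    push_cast
    ring
  rw [laguerreMhardErr_apply, laguerreMhard_apply, hx]
  simp only [gradMatRect, sMatRect, Matrix.of_apply, Fin.val_succ, if_true, or_true,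
    Nat.succ_ne_self, if_false]
  rw [sqrt_two_div_mul_sqrt (besselH_pos ha n)]
  ring

/-- Second-order remainder bound for the square root, uniform on `x ≥ ε`. -/
lemma abs_sqrt_add_sub_le {ε x d : ℝ} (hε : 0 < ε) (hx : ε ≤ x) (hxd : 0 ≤ x + d) :
    |√(x + d) - √x - d / (2 * √x)| ≤ d ^ 2 / (2 * √ε ^ 3) := by
  have hε' : 0 < √ε := Real.sqrt_pos.2 hε
  have hεx : √ε ≤ √x := Real.sqrt_le_sqrt hx
  have ht : 0 < √x := hε'.trans_le hεx
  have hs : 0 ≤ √(x + d) := Real.sqrt_nonneg _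
  have hd : d = √(x + d) ^ 2 - √x ^ 2 := by
    rw [Real.sq_sqrt hxd, Real.sq_sqrt (hε.le.trans hx)]
    ring
  generalize √(x + d) = s at *
  generalize √x = t at *
  subst hd
  have key : s - t - (s ^ 2 - t ^ 2) / (2 * t) = -((s - t) ^ 2 / (2 * t)) := by
    field_simp
    ring
  rw [key, abs_neg, abs_of_nonneg (by positivity)]
  calc (s - t) ^ 2 / (2 * t) ≤ (s ^ 2 - t ^ 2) ^ 2 / (2 * t ^ 3) := by
        rw [div_le_div_iff₀ (by positivity) (by positivity)]
        have h : t ^ 2 ≤ (s + t) ^ 2 := by gcongr; linarith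
        have := mul_le_mul_of_nonneg_left h (show 0 ≤ (s - t) ^ 2 * (2 * t) by positivity)
        linarith
    _ ≤ (s ^ 2 - t ^ 2) ^ 2 / (2 * √ε ^ 3) := by gcongr

/-- the hard-edge–scaled rectangular ∞-Laguerre matrix model is a
finite difference scheme for the Bessel operator `−2√x d/dx + (a−1)/√x`: the
error term `E` is upper bidiagonal with the stated explicit entries, and for
each `ε > 0` its entries in rows `i ≥ ε/h` are uniformly `O(h)`. -/
theorem laguerreMhard_finite_difference (a : ℝ) (ha : 0 < a) :
    (∀ n : ℕ, 1 ≤ n → ∀ (i : Fin n) (j : Fin (n + 1)),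
      (j : ℕ) ≠ (i : ℕ) → (j : ℕ) ≠ (i : ℕ) + 1 → laguerreMhardErr a n i j = 0) ∧
    (∀ n : ℕ, 1 ≤ n → ∀ i : Fin n,
      laguerreMhardErr a n i i.castSucc =
        (1 / besselH a n) *
            (Real.sqrt (besselX' a n (2 * (i : ℕ) + 2) + besselH a n * (a - 1))
              - Real.sqrt (besselX' a n (2 * (i : ℕ) + 2)))
          - (a - 1) / (2 * Real.sqrt (besselX' a n (2 * (i : ℕ) + 2)))) ∧
    (∀ n : ℕ, 1 ≤ n → ∀ i : Fin n,
      laguerreMhardErr a n i i.succ =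
        -(1 / besselH a n) *
            (Real.sqrt (besselX' a n (2 * (i : ℕ) + 2) - besselH a n * (a - 1))
              - Real.sqrt (besselX' a n (2 * (i : ℕ) + 2)))
          - (a - 1) / (2 * Real.sqrt (besselX' a n (2 * (i : ℕ) + 2)))) ∧
    (∀ ε : ℝ, 0 < ε → ∃ C > (0 : ℝ), ∃ n₀ : ℕ, ∀ n : ℕ, n₀ ≤ n →
      ∀ (i : Fin n) (j : Fin (n + 1)),
        ε / besselH a n ≤ ((i : ℕ) + 1 : ℝ) →
          |laguerreMhardErr a n i j| ≤ C * besselH a n) := by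
  refine ⟨fun n _ i j => laguerreMhardErr_eq_zero a n i j,
    fun n _ i => laguerreMhardErr_castSucc ha n i,
    fun n _ i => laguerreMhardErr_succ ha n i, fun ε hε => ?_⟩
  refine ⟨(a - 1) ^ 2 / (2 * √ε ^ 3) + 1, by positivity, 0, fun n _ i j hi => ?_⟩
  have hh := besselH_pos ha n
  have hxε : ε ≤ besselX' a n (2 * (i : ℕ) + 2) := by
    rw [div_le_iff₀ hh] at hi
    have h : besselH a n * ((i : ℕ) + 1) ≤ besselH a n * (a - 1 + (2 * (i : ℕ) + 2)) := by
      refine mul_le_mul_of_nonneg_left ?_ hh.le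
      linarith [(Nat.cast_nonneg (i : ℕ) : (0 : ℝ) ≤ (i : ℕ))]
    simp only [besselX']
    push_cast
    linarith
  have hadd : 0 ≤ besselX' a n (2 * (i : ℕ) + 2) + besselH a n * (a - 1) := by
    have : besselX' a n (2 * (i : ℕ) + 2) + besselH a n * (a - 1)
        = besselH a n * (2 * (a + (i : ℕ))) := by
      simp only [besselX']
      push_cast
      ring
    rw [this]
    positivity
  have hsub : 0 ≤ besselX' a n (2 * (i : ℕ) + 2) + -(besselH a n * (a - 1)) := by
    have : besselX' a n (2 * (i : ℕ) + 2) + -(besselH a n * (a - 1))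
        = besselH a n * (2 * ((i : ℕ) + 1)) := by
      simp only [besselX']
      push_cast
      ring
    rw [this]
    positivity
  have hbound : ∀ y : ℝ, |y| ≤ (besselH a n * (a - 1)) ^ 2 / (2 * √ε ^ 3) →
      |1 / besselH a n * y| ≤ ((a - 1) ^ 2 / (2 * √ε ^ 3) + 1) * besselH a n := by
    intro y hy
    rw [abs_mul, abs_of_pos (one_div_pos.2 hh)]
    calc 1 / besselH a n * |y|
        ≤ 1 / besselH a n * ((besselH a n * (a - 1)) ^ 2 / (2 * √ε ^ 3)) := by gcongr
      _ = (a - 1) ^ 2 / (2 * √ε ^ 3) * besselH a n := by field_simp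
      _ ≤ ((a - 1) ^ 2 / (2 * √ε ^ 3) + 1) * besselH a n := by gcongr; linarith
  by_cases h₁ : (j : ℕ) = i
  · obtain rfl : j = i.castSucc := Fin.ext h₁
    rw [laguerreMhardErr_castSucc ha]
    convert hbound _ (abs_sqrt_add_sub_le hε hxε hadd) using 2
    field_simp
  by_cases h₂ : (j : ℕ) = i + 1
  · obtain rfl : j = i.succ := Fin.ext h₂
    rw [laguerreMhardErr_succ ha, ← abs_neg]
    have hrem := abs_sqrt_add_sub_le hε hxε hsub
    rw [neg_sq] at hrem
    convert hbound _ hrem using 2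
    rw [← sub_eq_add_neg]
    field_simp
    ring
  · rw [laguerreMhardErr_eq_zero a n i j h₁ h₂, abs_zero]
    positivity

end
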